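/- arXiv:1810.12870 — 9 statements merged into one kernel-verified Lean document; each statement's English description precedes it below -/
import Mathlib

section
/- Convergence of the Bellman images (core of Proposition 3.3): let B : (ℝⁿ → ℝ̄) → (ℝⁿ → ℝ̄) be order preserving, let K, K′ ⊆ ℝⁿ be compact sets, let M > 0, let W : ℝⁿ → ℝ̄ be real-valued on K′, and let (W_k)_{k∈ℕ} be a pointwise nonincreasing sequence of functions with W_k ≥ W pointwise on ℝⁿ and such that sup_{x∈K′} (W_k(x) − W(x)) → 0 as k → ∞. Assume: (i) for every ε > 0, B(W + ε + δ_{K′}) ≤ B(W + ε) + δ_K pointwise (existence of optimal sets), and (ii) for every ε > 0, B(W + ε) ≤ B(W) + Mε pointwise on K (additive M-subhomogeneity on K). Then for every x ∈ K, the nonincreasing sequence (B(W_k)(x))_{k∈ℕ} converges in ℝ̄ to B(W)(x). -/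
open Classical

/-- `erestrict f S` is the function `f + δ_S` of the paper, where `δ_S` is the indicator
function equal to `0` on `S` and `+∞` outside `S`, with the paper's convention that
`+∞` dominates in additions (in particular `(-∞) + (+∞) = +∞`). -/
noncomputable def erestrict {X : Type*} (f : X → EReal) (S : Set X) : X → EReal :=
  fun x => if x ∈ S then f x else ⊤

/-- Every element above `a : EReal` is above `a + M * ε` for some positive real `ε`. -/
theorem exists_pos_add_mul_lt_ereal {a b : EReal} (hab : a < b) {M : ℝ} (hM : 0 < M) :
    ∃ ε : ℝ, 0 < ε ∧ a + ((M * ε : ℝ) : EReal) < b := by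
  obtain ⟨r, har, hrb⟩ := EReal.lt_iff_exists_real_btwn.1 hab
  induction a with
  | bot => exact ⟨1, one_pos, by rwa [EReal.bot_add]⟩
  | top => exact absurd hab not_top_lt
  | coe w =>
    refine ⟨(r - w) / M, div_pos (sub_pos.2 (EReal.coe_lt_coe_iff.1 har)) hM, ?_⟩
    rwa [mul_div_cancel₀ _ hM.ne', ← EReal.coe_add, add_sub_cancel]

/-- Convergence of the Bellman images (core of Proposition 3.3): if `B` is order
preserving, `(W_k)` is nonincreasing, bounded below by `W`, converges uniformly to `W`
on the compact `K'`, and `B` admits optimal sets (`B(W + ε + δ_{K'}) ≤ B(W + ε) + δ_K`)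
and is additively `M`-subhomogeneous on `K`, then for every `x ∈ K` the nonincreasing
sequence `(B(W_k)(x))` converges to `B(W)(x)` in `ℝ̄`. -/
theorem stmt_4
    (n : ℕ)
    (B : (EuclideanSpace ℝ (Fin n) → EReal) → (EuclideanSpace ℝ (Fin n) → EReal))
    -- order preserving
    (hB : ∀ f g : EuclideanSpace ℝ (Fin n) → EReal,
      (∀ y, f y ≤ g y) → ∀ y, B f y ≤ B g y)
    (K K' : Set (EuclideanSpace ℝ (Fin n)))
    (hKc : IsCompact K) (hK'c : IsCompact K')
    (M : ℝ) (hM : 0 < M)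
    (W : EuclideanSpace ℝ (Fin n) → EReal)
    -- W is real-valued on K'
    (hWreal : ∀ x ∈ K', ∃ r : ℝ, W x = (r : EReal))
    (Wk : ℕ → EuclideanSpace ℝ (Fin n) → EReal)
    -- pointwise nonincreasing and bounded below by W
    (hWkmono : ∀ k, ∀ y, Wk (k + 1) y ≤ Wk k y)
    (hWkge : ∀ k, ∀ y, W y ≤ Wk k y)
    -- sup_{x ∈ K'} (W_k(x) − W(x)) → 0
    (hconv : ∀ ε : ℝ, 0 < ε → ∃ N : ℕ, ∀ k ≥ N, ∀ x ∈ K', Wk k x ≤ W x + (ε : EReal))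
    -- (i) existence of optimal sets: B(W + ε + δ_{K'}) ≤ B(W + ε) + δ_K pointwise
    (hopt : ∀ ε : ℝ, 0 < ε → ∀ x,
      B (erestrict (fun y => W y + (ε : EReal)) K') x
        ≤ erestrict (B (fun y => W y + (ε : EReal))) K x)
    -- (ii) additive M-subhomogeneity on K: B(W + ε) ≤ B(W) + Mε on K
    (hsub : ∀ ε : ℝ, 0 < ε → ∀ x ∈ K,
      B (fun y => W y + (ε : EReal)) x ≤ B W x + ((M * ε : ℝ) : EReal)) :
    ∀ x ∈ K, Antitone (fun k => B (Wk k) x) ∧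
      Filter.Tendsto (fun k => B (Wk k) x) Filter.atTop (nhds (B W x)) := by
  intro x hx
  refine ⟨antitone_nat_of_succ_le fun k => hB _ _ (hWkmono k) x, tendsto_order.2 ⟨?_, ?_⟩⟩
  · exact fun a ha => Filter.Eventually.of_forall fun k => ha.trans_le (hB _ _ (hWkge k) x)
  · intro b hb
    obtain ⟨ε, hε, hlt⟩ := exists_pos_add_mul_lt_ereal hb hM
    obtain ⟨N, hN⟩ := hconv ε hε
    filter_upwards [Filter.eventually_ge_atTop N] with k hk
    have hle : ∀ y, Wk k y ≤ erestrict (fun y => W y + (ε : EReal)) K' y := by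
      intro y
      unfold erestrict
      split_ifs with hy
      · exact hN k hk y hy
      · exact le_top
    have hBε := hopt ε hε x
    rw [erestrict.eq_def (B _), if_pos hx] at hBε
    exact (((hB _ _ hle x).trans hBε).trans (hsub ε hε x hx)).trans_lt hlt
end

section
/- Unicity in restricted Bellman equations (Lemma 3.5, case opt = inf): let X_t ⊆ dom V_t for t ∈ {0,…,T} be sets that are optimal with respect to (V_t), i.e. B_t(V_{t+1} + δ_{X_{t+1}}) + δ_{X_t} = B_t(V_{t+1}) + δ_{X_t} for every t ∈ {0,…,T−1}. Let W_t : X → ℝ̄ (t ∈ {0,…,T}) be functions satisfying W_t ≥ V_t pointwise for every t, W_T + δ_{X_T} = ψ + δ_{X_T}, and B_t(W_{t+1}) + δ_{X_t} = W_t + δ_{X_t} for every t ∈ {0,…,T−1}. Then for every t ∈ {0,…,T} and every x ∈ X_t one has W_t(x) = V_t(x). -/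
open Classical

/-- Unicity in restricted Bellman equations (Lemma 3.5, case `opt = inf`): if the sets
`X_t ⊆ dom V_t` are optimal with respect to `(V_t)` and the functions `W_t ≥ V_t`
satisfy the restricted Bellman equations, then `W_t = V_t` on `X_t` for every `t`. -/
theorem stmt_5
    (n T : ℕ) (hT : 1 ≤ T)
    -- the Bellman operators, order preserving for `t < T`
    (B : ℕ → (EuclideanSpace ℝ (Fin n) → EReal) → (EuclideanSpace ℝ (Fin n) → EReal))
    (hB : ∀ t < T, ∀ f g : EuclideanSpace ℝ (Fin n) → EReal,
      (∀ y, f y ≤ g y) → ∀ y, B t f y ≤ B t g y)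
    -- the value functions : `V T = ψ`, `V t = B t (V (t+1))`
    (ψ : EuclideanSpace ℝ (Fin n) → EReal)
    (V : ℕ → EuclideanSpace ℝ (Fin n) → EReal)
    (hVT : V T = ψ)
    (hV : ∀ t < T, V t = B t (V (t + 1)))
    -- the sets `X_t`, included in `dom V_t`
    (Xs : ℕ → Set (EuclideanSpace ℝ (Fin n)))
    (hdom : ∀ t ≤ T, ∀ x ∈ Xs t, V t x < ⊤)
    -- optimality with respect to `(V_t)`:
    -- `B_t(V_{t+1} + δ_{X_{t+1}}) + δ_{X_t} = B_t(V_{t+1}) + δ_{X_t}`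
    (hoptimal : ∀ t < T, ∀ x ∈ Xs t,
      B t (erestrict (V (t + 1)) (Xs (t + 1))) x = B t (V (t + 1)) x)
    -- the functions `W_t`, bounded below by `V_t`
    (W : ℕ → EuclideanSpace ℝ (Fin n) → EReal)
    (hWge : ∀ t ≤ T, ∀ x, V t x ≤ W t x)
    -- restricted Bellman equations: `W_T + δ_{X_T} = ψ + δ_{X_T}` and
    -- `B_t(W_{t+1}) + δ_{X_t} = W_t + δ_{X_t}`
    (hWT : ∀ x ∈ Xs T, W T x = ψ x)
    (hWrec : ∀ t < T, ∀ x ∈ Xs t, B t (W (t + 1)) x = W t x) :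
    ∀ t ≤ T, ∀ x ∈ Xs t, W t x = V t x := by
  intro t ht
  induction ht using Nat.decreasingInduction with
  | self =>
    intro x hx
    rw [hWT x hx, hVT]
  | of_succ t ht ih =>
    intro x hx
    refine le_antisymm ?_ (hWge t ht.le x)
    rw [← hWrec t ht x hx, hV t ht, ← hoptimal t ht x hx]
    refine hB t ht _ _ (fun y => ?_) x
    unfold erestrict
    split_ifs with hy
    · exact (ih y hy).le
    · exact le_top
end

section
/- Unicity in restricted Bellman equations (Lemma 3.5, case opt = sup): let W_t : X → ℝ̄ (t ∈ {0,…,T}) be functions and let X_t ⊆ dom V_t for t ∈ {0,…,T} be sets that are optimal with respect to (W_t), i.e. B_t(W_{t+1} + δ_{X_{t+1}}) + δ_{X_t} = B_t(W_{t+1}) + δ_{X_t} for every t ∈ {0,…,T−1}. Assume W_t ≤ V_t pointwise for every t, W_T + δ_{X_T} = ψ + δ_{X_T}, and B_t(W_{t+1}) + δ_{X_t} = W_t + δ_{X_t} for every t ∈ {0,…,T−1}. Then for every t ∈ {0,…,T} and every x ∈ X_t one has W_t(x) = V_t(x). -/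
open Classical

/-- Unicity in restricted Bellman equations (Lemma 3.5, case `opt = sup`): if the sets
`X_t ⊆ dom V_t` are optimal with respect to `(W_t)` and the functions `W_t ≤ V_t`
satisfy the restricted Bellman equations, then `W_t = V_t` on `X_t` for every `t`. -/
theorem stmt_6
    (n T : ℕ) (hT : 1 ≤ T)
    -- the Bellman operators, order preserving for `t < T`
    (B : ℕ → (EuclideanSpace ℝ (Fin n) → EReal) → (EuclideanSpace ℝ (Fin n) → EReal))
    (hB : ∀ t < T, ∀ f g : EuclideanSpace ℝ (Fin n) → EReal,
      (∀ y, f y ≤ g y) → ∀ y, B t f y ≤ B t g y)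
    -- the value functions : `V T = ψ`, `V t = B t (V (t+1))`
    (ψ : EuclideanSpace ℝ (Fin n) → EReal)
    (V : ℕ → EuclideanSpace ℝ (Fin n) → EReal)
    (hVT : V T = ψ)
    (hV : ∀ t < T, V t = B t (V (t + 1)))
    -- the sets `X_t`, included in `dom V_t`
    (Xs : ℕ → Set (EuclideanSpace ℝ (Fin n)))
    (hdom : ∀ t ≤ T, ∀ x ∈ Xs t, V t x < ⊤)
    -- the functions `W_t`, bounded above by `V_t`
    (W : ℕ → EuclideanSpace ℝ (Fin n) → EReal)
    (hWle : ∀ t ≤ T, ∀ x, W t x ≤ V t x)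
    -- optimality with respect to `(W_t)`:
    -- `B_t(W_{t+1} + δ_{X_{t+1}}) + δ_{X_t} = B_t(W_{t+1}) + δ_{X_t}`
    (hoptimal : ∀ t < T, ∀ x ∈ Xs t,
      B t (erestrict (W (t + 1)) (Xs (t + 1))) x = B t (W (t + 1)) x)
    -- restricted Bellman equations: `W_T + δ_{X_T} = ψ + δ_{X_T}` and
    -- `B_t(W_{t+1}) + δ_{X_t} = W_t + δ_{X_t}`
    (hWT : ∀ x ∈ Xs T, W T x = ψ x)
    (hWrec : ∀ t < T, ∀ x ∈ Xs t, B t (W (t + 1)) x = W t x) :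
    ∀ t ≤ T, ∀ x ∈ Xs t, W t x = V t x := by
  intro t ht
  induction ht using Nat.decreasingInduction with
  | self => simpa only [hVT] using hWT
  | of_succ t ht ih =>
    intro x hx
    refine le_antisymm (hWle t ht.le x) ?_
    have hle : ∀ y, V (t + 1) y ≤ erestrict (W (t + 1)) (Xs (t + 1)) y := by
      intro y
      by_cases hy : y ∈ Xs (t + 1)
      · simp [erestrict, hy, ih y hy]
      · simp [erestrict, hy]
    calc V t x = B t (V (t + 1)) x := by rw [← hV t ht]
      _ ≤ B t (erestrict (W (t + 1)) (Xs (t + 1))) x := hB t ht _ _ hle x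
      _ = B t (W (t + 1)) x := hoptimal t ht x hx
      _ = W t x := hWrec t ht x hx
end

section
/- Restricted Bellman inequality at cluster points of the trial points (deterministic core of Theorem 3.6, inf case): fix t ∈ {0,…,T−1} and x ∈ X, and let V_s^*(y) := inf_{k≥1} V_s^k(y) denote the pointwise limit of the nonincreasing approximations. Assume: (i) there is r > 0 such that all V_t^k (k ≥ 1) are real-valued on the closed ball B̄(x,r), and the family (V_t^k)_{k≥1} is equicontinuous at x (for every ε > 0 there is δ ∈ (0,r] such that |V_t^k(y) − V_t^k(x)| ≤ ε for all k ≥ 1 and all y with ‖y − x‖ ≤ δ); (ii) the functions B_t(V_{t+1}^k) are real-valued on B̄(x,r) and converge uniformly on B̄(x,r) to B_t(V_{t+1}^*) as k → ∞; (iii) B_t(V_{t+1}^*) is continuous at x; (iv) some subsequence of the trial points (x_t^{k})_{k∈ℕ} converges to x. Then V_t^*(x) ≤ B_t(V_{t+1}^*)(x). -/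
/-- Restricted Bellman inequality at cluster points of the trial points (deterministic
core of Theorem 3.6, case `opt = inf`): under equicontinuity and real-valuedness of the
approximations near `x`, uniform convergence of the Bellman images, continuity of
`B_t(V_{t+1}^*)` at `x`, and the existence of a subsequence of trial points converging
to `x`, one has `V_t^*(x) ≤ B_t(V_{t+1}^*)(x)`. -/
theorem stmt_7
    (n T : ℕ) (hT : 1 ≤ T)
    -- the Bellman operators, order preserving for `t < T`
    (B : ℕ → (EuclideanSpace ℝ (Fin n) → EReal) → (EuclideanSpace ℝ (Fin n) → EReal))
    (hB : ∀ t < T, ∀ f g : EuclideanSpace ℝ (Fin n) → EReal,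
      (∀ y, f y ≤ g y) → ∀ y, B t f y ≤ B t g y)
    -- the value functions : `V T = ψ`, `V t = B t (V (t+1))`
    (ψ : EuclideanSpace ℝ (Fin n) → EReal)
    (V : ℕ → EuclideanSpace ℝ (Fin n) → EReal)
    (hVT : V T = ψ)
    (hV : ∀ t < T, V t = B t (V (t + 1)))
    -- trial points `x_t^k = xpt t k` and selected basic functions `φ_t^k = φ t k`
    (xpt : ℕ → ℕ → EuclideanSpace ℝ (Fin n))
    (φ : ℕ → ℕ → EuclideanSpace ℝ (Fin n) → EReal)
    -- approximations `V_t^k = Vk t k`, with `V_t^0 ≡ +∞` and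
    -- `V_t^k = min (φ_t^1, …, φ_t^k)` pointwise
    (Vk : ℕ → ℕ → EuclideanSpace ℝ (Fin n) → EReal)
    (hVk0 : ∀ t, Vk t 0 = fun _ => (⊤ : EReal))
    (hVkS : ∀ t k, Vk t (k + 1) = fun y => min (Vk t k y) (φ t (k + 1) y))
    -- validity and tightness of the selections
    (hvalT : ∀ k, 1 ≤ k → ∀ y, ψ y ≤ φ T k y)
    (htightT : ∀ k, 1 ≤ k → φ T k (xpt T (k - 1)) = ψ (xpt T (k - 1)))
    (hval : ∀ t < T, ∀ k, 1 ≤ k → ∀ y, B t (Vk (t + 1) k) y ≤ φ t k y)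
    (htight : ∀ t < T, ∀ k, 1 ≤ k →
      φ t k (xpt t (k - 1)) = B t (Vk (t + 1) k) (xpt t (k - 1)))
    -- `V_s^* = inf_{k ≥ 1} V_s^k`, the pointwise limit of the approximations
    (Vstar : ℕ → EuclideanSpace ℝ (Fin n) → EReal)
    (hVstar : ∀ s y, Vstar s y = ⨅ k : ℕ, Vk s (k + 1) y)
    -- fix `t ∈ {0,…,T−1}` and `x ∈ X`
    (t : ℕ) (ht : t < T) (x : EuclideanSpace ℝ (Fin n))
    (r : ℝ) (hr : 0 < r)
    -- (i) the `V_t^k`, `k ≥ 1`, are real-valued on the closed ball `B̄(x,r)` and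
    -- equicontinuous at `x`
    (hreal : ∀ k, 1 ≤ k → ∀ y ∈ Metric.closedBall x r,
      Vk t k y ≠ ⊤ ∧ Vk t k y ≠ ⊥)
    (hequi : ∀ ε : ℝ, 0 < ε → ∃ δ : ℝ, 0 < δ ∧ δ ≤ r ∧ ∀ k, 1 ≤ k → ∀ y,
      dist y x ≤ δ → |(Vk t k y).toReal - (Vk t k x).toReal| ≤ ε)
    -- (ii) the `B_t(V_{t+1}^k)` are real-valued on `B̄(x,r)` and converge uniformly
    -- on `B̄(x,r)` to `B_t(V_{t+1}^*)`
    (hBreal : ∀ k, 1 ≤ k → ∀ y ∈ Metric.closedBall x r,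
      B t (Vk (t + 1) k) y ≠ ⊤ ∧ B t (Vk (t + 1) k) y ≠ ⊥)
    (hBlimreal : ∀ y ∈ Metric.closedBall x r,
      B t (Vstar (t + 1)) y ≠ ⊤ ∧ B t (Vstar (t + 1)) y ≠ ⊥)
    (hunif : ∀ ε : ℝ, 0 < ε → ∃ N : ℕ, ∀ k ≥ N, ∀ y ∈ Metric.closedBall x r,
      |(B t (Vk (t + 1) k) y).toReal - (B t (Vstar (t + 1)) y).toReal| ≤ ε)
    -- (iii) `B_t(V_{t+1}^*)` is continuous at `x`
    (hcont : ContinuousAt (fun y => B t (Vstar (t + 1)) y) x)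
    -- (iv) a subsequence of the trial points converges to `x`
    (hsub : ∃ σ : ℕ → ℕ, StrictMono σ ∧
      Filter.Tendsto (fun k => xpt t (σ k)) Filter.atTop (nhds x)) :
    Vstar t x ≤ B t (Vstar (t + 1)) x := by
  obtain ⟨σ, hσ, hlim⟩ := hsub
  have hx : x ∈ Metric.closedBall x r := Metric.mem_closedBall_self hr.le
  refine EReal.le_of_forall_lt_iff_le.mp fun z hz => ?_
  set a := (B t (Vstar (t + 1)) x).toReal
  have ha : (a : EReal) = B t (Vstar (t + 1)) x :=
    EReal.coe_toReal (hBlimreal x hx).1 (hBlimreal x hx).2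
  rw [← ha, EReal.coe_lt_coe_iff] at hz
  have hε : 0 < (z - a) / 3 := by linarith
  obtain ⟨δ, hδ, hδr, hVδ⟩ := hequi _ hε
  obtain ⟨N, hN⟩ := hunif _ hε
  have hcontReal : ContinuousAt (fun y => (B t (Vstar (t + 1)) y).toReal) x :=
    (EReal.tendsto_toReal (hBlimreal x hx).1 (hBlimreal x hx).2).comp hcont
  have hBnear : ∀ᶠ y in nhds x, (B t (Vstar (t + 1)) y).toReal < a + (z - a) / 3 :=
    hcontReal.eventually_lt_const (lt_add_of_pos_right _ hε)
  obtain ⟨j, hjδ, hjB, hjN⟩ :=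
    ((hlim.eventually (Metric.closedBall_mem_nhds x hδ)).and
      ((hlim.eventually hBnear).and (Filter.eventually_ge_atTop N))).exists
  set y := xpt t (σ j)
  have hk : 1 ≤ σ j + 1 := Nat.le_add_left 1 _
  have hkN : N ≤ σ j + 1 := (hjN.trans (hσ.id_le j)).trans (Nat.le_succ _)
  have hy : y ∈ Metric.closedBall x r := Metric.closedBall_subset_closedBall hδr hjδ
  have hle : Vk t (σ j + 1) y ≤ B t (Vk (t + 1) (σ j + 1)) y := by
    rw [hVkS]
    exact (min_le_right _ _).trans (htight t ht (σ j + 1) hk).le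
  have hleReal : (Vk t (σ j + 1) y).toReal ≤ (B t (Vk (t + 1) (σ j + 1)) y).toReal :=
    EReal.toReal_le_toReal hle (hreal _ hk y hy).2 (hBreal _ hk y hy).1
  have hV_close := (abs_le.mp (hVδ _ hk y hjδ)).1
  have hB_close := (abs_le.mp (hN _ hkN y hy)).2
  calc
    Vstar t x ≤ Vk t (σ j + 1) x := by
      rw [hVstar]
      exact iInf_le (fun k => Vk t (k + 1) x) (σ j)
    _ = ((Vk t (σ j + 1) x).toReal : EReal) :=
      (EReal.coe_toReal (hreal _ hk x hx).1 (hreal _ hk x hx).2).symm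
    _ ≤ z := EReal.coe_le_coe_iff.mpr (by linarith)
end

section
/- Convergence of Tropical Dynamic Programming (deterministic form of Theorem 3.6, inf case): let V_s^*(y) := inf_{k≥1} V_s^k(y) be the pointwise limit of the approximations, and let K_t^* ⊆ dom V_t (t ∈ {0,…,T}) be sets that are optimal with respect to (V_t), i.e. B_t(V_{t+1} + δ_{K_{t+1}^*}) + δ_{K_t^*} = B_t(V_{t+1}) + δ_{K_t^*} for every t ∈ {0,…,T−1}. Assume: (a) for every t ∈ {0,…,T−1} and every x ∈ K_t^*: the family (V_t^k)_{k≥1} is real-valued and equicontinuous at x on some closed ball B̄(x,r), the functions B_t(V_{t+1}^k) are real-valued on B̄(x,r) and converge uniformly on B̄(x,r) to B_t(V_{t+1}^*), B_t(V_{t+1}^*) is continuous at x, B_t(V_{t+1}^*) ≤ V_t^* pointwise on X, and some subsequence of the trial points (x_t^k)_{k∈ℕ} converges to x; (b) for every x ∈ K_T^*: the family (V_T^k)_{k≥1} is real-valued and equicontinuous at x on some closed ball around x, V_T is continuous at x, and some subsequence of (x_T^k)_{k∈ℕ} converges to x. Then for every t ∈ {0,…,T} and every x ∈ K_t^*, V_t^*(x)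 = V_t(x). -/
open Classical

/-- If a family of functions is equicontinuous at `x`, `F` is continuous at `x`, and along some
sequence `z → x` suitable members of the family asymptotically lie below `F` at `z j`, then the
infimum of the family lies below `F` at `x`. -/
theorem iInf_le_of_equicontinuous_of_tendsto {E : Type*} [PseudoMetricSpace E]
    {u : ℕ → E → EReal} {F : E → EReal} {x : E} {r : ℝ}
    (hreal : ∀ k, 1 ≤ k → ∀ y ∈ Metric.closedBall x r, u k y ≠ ⊤ ∧ u k y ≠ ⊥)
    (hequi : ∀ ε : ℝ, 0 < ε → ∃ δ : ℝ, 0 < δ ∧ δ ≤ r ∧ ∀ k, 1 ≤ k → ∀ y,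
      dist y x ≤ δ → |(u k y).toReal - (u k x).toReal| ≤ ε)
    (hF : ContinuousAt F x) {z : ℕ → E} (hz : Filter.Tendsto z Filter.atTop (nhds x))
    {κ : ℕ → ℕ}
    (h : ∀ ε : ℝ, 0 < ε → ∀ᶠ j in Filter.atTop, u (κ j + 1) (z j) ≤ F (z j) + (ε : EReal)) :
    ⨅ k : ℕ, u (k + 1) x ≤ F x := by
  refine EReal.le_of_forall_lt_iff_le.1 fun c hc => ?_
  obtain ⟨c', hc', hcc'⟩ := EReal.lt_iff_exists_real_btwn.1 hc
  have hlt : c' < c := EReal.coe_lt_coe_iff.1 hcc'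
  have hε : 0 < (c - c') / 2 := by linarith
  obtain ⟨δ, hδ, hδr, hu⟩ := hequi _ hε
  have hFz : ∀ᶠ j in Filter.atTop, F (z j) < c' := (hF.tendsto.comp hz).eventually_lt_const hc'
  have hzδ : ∀ᶠ j in Filter.atTop, z j ∈ Metric.closedBall x δ :=
    hz (Metric.closedBall_mem_nhds x hδ)
  obtain ⟨j, hj, hFj, hzj⟩ := ((h _ hε).and (hFz.and hzδ)).exists
  have hk : 1 ≤ κ j + 1 := Nat.le_add_left 1 _
  have hz_real := hreal _ hk _ (Metric.closedBall_subset_closedBall hδr hzj)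
  have hx_real := hreal _ hk _ (Metric.mem_closedBall_self (hδ.le.trans hδr))
  have hdiff := (abs_le.1 (hu _ hk _ hzj)).1
  have hzc : u (κ j + 1) (z j) ≤ ((c' + (c - c') / 2 : ℝ) : EReal) := by
    rw [EReal.coe_add]
    exact hj.trans (by gcongr)
  rw [← EReal.coe_toReal hz_real.1 hz_real.2, EReal.coe_le_coe_iff] at hzc
  refine (iInf_le _ (κ j)).trans ?_
  rw [← EReal.coe_toReal hx_real.1 hx_real.2, EReal.coe_le_coe_iff]
  linarith

/-- Convergence of Tropical Dynamic Programming (deterministic form of Theorem 3.6,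
case `opt = inf`): if the sets `K_t^* ⊆ dom V_t` are optimal with respect to `(V_t)`,
and the regularity, uniform-convergence, continuity and cluster-point assumptions (a)
and (b) hold, then `V_t^* = V_t` on `K_t^*` for every `t ∈ {0,…,T}`. -/
theorem stmt_8
    (n T : ℕ) (hT : 1 ≤ T)
    -- the Bellman operators, order preserving for `t < T`
    (B : ℕ → (EuclideanSpace ℝ (Fin n) → EReal) → (EuclideanSpace ℝ (Fin n) → EReal))
    (hB : ∀ t < T, ∀ f g : EuclideanSpace ℝ (Fin n) → EReal,
      (∀ y, f y ≤ g y) → ∀ y, B t f y ≤ B t g y)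
    -- the value functions : `V T = ψ`, `V t = B t (V (t+1))`
    (ψ : EuclideanSpace ℝ (Fin n) → EReal)
    (V : ℕ → EuclideanSpace ℝ (Fin n) → EReal)
    (hVT : V T = ψ)
    (hV : ∀ t < T, V t = B t (V (t + 1)))
    -- trial points `x_t^k = xpt t k` and selected basic functions `φ_t^k = φ t k`
    (xpt : ℕ → ℕ → EuclideanSpace ℝ (Fin n))
    (φ : ℕ → ℕ → EuclideanSpace ℝ (Fin n) → EReal)
    -- approximations `V_t^k = Vk t k`, with `V_t^0 ≡ +∞` and
    -- `V_t^k = min (φ_t^1, …, φ_t^k)` pointwise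
    (Vk : ℕ → ℕ → EuclideanSpace ℝ (Fin n) → EReal)
    (hVk0 : ∀ t, Vk t 0 = fun _ => (⊤ : EReal))
    (hVkS : ∀ t k, Vk t (k + 1) = fun y => min (Vk t k y) (φ t (k + 1) y))
    -- validity and tightness of the selections
    (hvalT : ∀ k, 1 ≤ k → ∀ y, ψ y ≤ φ T k y)
    (htightT : ∀ k, 1 ≤ k → φ T k (xpt T (k - 1)) = ψ (xpt T (k - 1)))
    (hval : ∀ t < T, ∀ k, 1 ≤ k → ∀ y, B t (Vk (t + 1) k) y ≤ φ t k y)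
    (htight : ∀ t < T, ∀ k, 1 ≤ k →
      φ t k (xpt t (k - 1)) = B t (Vk (t + 1) k) (xpt t (k - 1)))
    -- `V_s^* = inf_{k ≥ 1} V_s^k`, the pointwise limit of the approximations
    (Vstar : ℕ → EuclideanSpace ℝ (Fin n) → EReal)
    (hVstar : ∀ s y, Vstar s y = ⨅ k : ℕ, Vk s (k + 1) y)
    -- the sets `K_t^*`, included in `dom V_t`
    (Ks : ℕ → Set (EuclideanSpace ℝ (Fin n)))
    (hdom : ∀ t ≤ T, ∀ x ∈ Ks t, V t x < ⊤)
    -- optimality with respect to `(V_t)`: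
    -- `B_t(V_{t+1} + δ_{K_{t+1}^*}) + δ_{K_t^*} = B_t(V_{t+1}) + δ_{K_t^*}`
    (hoptimal : ∀ t < T, ∀ x ∈ Ks t,
      B t (erestrict (V (t + 1)) (Ks (t + 1))) x = B t (V (t + 1)) x)
    -- assumption (a), for every `t < T`
    (ha : ∀ t < T,
      -- `B_t(V_{t+1}^*) ≤ V_t^*` pointwise on `X`
      (∀ y, B t (Vstar (t + 1)) y ≤ Vstar t y) ∧
      ∀ x ∈ Ks t, ∃ r : ℝ, 0 < r ∧
        -- the `V_t^k`, `k ≥ 1`, are real-valued on `B̄(x,r)` and equicontinuous at `x`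
        (∀ k, 1 ≤ k → ∀ y ∈ Metric.closedBall x r, Vk t k y ≠ ⊤ ∧ Vk t k y ≠ ⊥) ∧
        (∀ ε : ℝ, 0 < ε → ∃ δ : ℝ, 0 < δ ∧ δ ≤ r ∧ ∀ k, 1 ≤ k → ∀ y,
          dist y x ≤ δ → |(Vk t k y).toReal - (Vk t k x).toReal| ≤ ε) ∧
        -- the `B_t(V_{t+1}^k)` are real-valued on `B̄(x,r)` and converge uniformly
        -- on `B̄(x,r)` to `B_t(V_{t+1}^*)`
        (∀ k, 1 ≤ k → ∀ y ∈ Metric.closedBall x r,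
          B t (Vk (t + 1) k) y ≠ ⊤ ∧ B t (Vk (t + 1) k) y ≠ ⊥) ∧
        (∀ y ∈ Metric.closedBall x r,
          B t (Vstar (t + 1)) y ≠ ⊤ ∧ B t (Vstar (t + 1)) y ≠ ⊥) ∧
        (∀ ε : ℝ, 0 < ε → ∃ N : ℕ, ∀ k ≥ N, ∀ y ∈ Metric.closedBall x r,
          |(B t (Vk (t + 1) k) y).toReal - (B t (Vstar (t + 1)) y).toReal| ≤ ε) ∧
        -- `B_t(V_{t+1}^*)` is continuous at `x`
        ContinuousAt (fun y => B t (Vstar (t + 1)) y) x ∧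
        -- a subsequence of the trial points converges to `x`
        (∃ σ : ℕ → ℕ, StrictMono σ ∧
          Filter.Tendsto (fun k => xpt t (σ k)) Filter.atTop (nhds x)))
    -- assumption (b), at time `T`
    (hb : ∀ x ∈ Ks T, ∃ r : ℝ, 0 < r ∧
        (∀ k, 1 ≤ k → ∀ y ∈ Metric.closedBall x r, Vk T k y ≠ ⊤ ∧ Vk T k y ≠ ⊥) ∧
        (∀ ε : ℝ, 0 < ε → ∃ δ : ℝ, 0 < δ ∧ δ ≤ r ∧ ∀ k, 1 ≤ k → ∀ y,
          dist y x ≤ δ → |(Vk T k y).toReal - (Vk T k x).toReal| ≤ ε) ∧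
        ContinuousAt (V T) x ∧
        (∃ σ : ℕ → ℕ, StrictMono σ ∧
          Filter.Tendsto (fun k => xpt T (σ k)) Filter.atTop (nhds x))) :
    ∀ t ≤ T, ∀ x ∈ Ks t, Vstar t x = V t x := by
  have hVk_ge : ∀ t (f : EuclideanSpace ℝ (Fin n) → EReal),
      (∀ k, 1 ≤ k → ∀ y, f y ≤ φ t k y) → ∀ k y, f y ≤ Vk t k y := by
    intro t f hf k
    induction k with
    | zero => simp [hVk0]
    | succ k ih =>
      intro y
      rw [hVkS]
      exact le_min (ih y) (hf _ (Nat.le_add_left 1 k) y)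
  have hVk_le : ∀ t k y, Vk t (k + 1) y ≤ φ t (k + 1) y := by
    intro t k y
    rw [hVkS]
    exact min_le_right _ _
  have hV_le_Vk : ∀ t ≤ T, ∀ k y, V t y ≤ Vk t k y := by
    intro t ht
    induction ht using Nat.decreasingInduction with
    | self => exact hVk_ge T _ (hVT ▸ hvalT)
    | of_succ t ht ih =>
      refine hVk_ge t _ fun k hk y => ?_
      rw [hV t ht]
      exact (hB t ht _ _ (ih k) y).trans (hval t ht k hk y)
  have hV_le : ∀ t ≤ T, ∀ y, V t y ≤ Vstar t y := by
    intro t ht y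
    rw [hVstar]
    exact le_iInf fun k => hV_le_Vk t ht _ y
  intro t ht
  induction ht using Nat.decreasingInduction with
  | self =>
    intro x hx
    obtain ⟨r, -, hreal, hequi, hcont, σ, -, hσ⟩ := hb x hx
    refine le_antisymm ?_ (hV_le T le_rfl x)
    rw [hVstar]
    refine iInf_le_of_equicontinuous_of_tendsto hreal hequi hcont hσ (κ := σ)
      fun ε hε => .of_forall fun j => ?_
    have htight_j := htightT (σ j + 1) (Nat.le_add_left 1 _)
    rw [Nat.add_sub_cancel, ← hVT] at htight_j
    exact ((hVk_le _ _ _).trans_eq htight_j).trans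
      (le_add_of_nonneg_right (EReal.coe_nonneg.2 hε.le))
  | of_succ t ht ih =>
    intro x hx
    obtain ⟨-, hloc⟩ := ha t ht
    obtain ⟨r, hr, hreal, hequi, hBreal, hBsreal, hunif, hcont, σ, hσmono, hσ⟩ := hloc x hx
    have hBV : B t (Vstar (t + 1)) x ≤ V t x := by
      rw [hV t ht, ← hoptimal t ht x hx]
      refine hB t ht _ _ (fun y => ?_) x
      unfold erestrict
      split_ifs with hy
      · exact (ih y hy).le
      · exact le_top
    refine le_antisymm (le_trans ?_ hBV) (hV_le t ht.le x)
    rw [hVstar]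
    refine iInf_le_of_equicontinuous_of_tendsto hreal hequi hcont hσ (κ := σ) fun ε hε => ?_
    obtain ⟨N, hN⟩ := hunif ε hε
    filter_upwards [hσ (Metric.closedBall_mem_nhds x hr), Filter.eventually_ge_atTop N]
      with j hj hNj
    have htight_j := htight t ht (σ j + 1) (Nat.le_add_left 1 _)
    rw [Nat.add_sub_cancel] at htight_j
    refine ((hVk_le _ _ _).trans_eq htight_j).trans ?_
    have hk_real := hBreal (σ j + 1) (Nat.le_add_left 1 _) _ hj
    have hs_real := hBsreal _ hj
    have hdiff := (abs_le.1 (hN (σ j + 1) (by have := hσmono.le_apply (x := j); omega) _ hj)).2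
    rw [← EReal.coe_toReal hk_real.1 hk_real.2, ← EReal.coe_toReal hs_real.1 hs_real.2,
      ← EReal.coe_add, EReal.coe_le_coe_iff]
    linarith
end

section
/- 2-homogeneity of the value functions of the switched linear-quadratic problem (Proposition 5.2): for every t ∈ {0,…,T}, the value function V_t is real-valued (all the infima defining it are finite) and 2-homogeneous, i.e. V_t(λx) = λ² V_t(x) for every x ∈ ℝⁿ and every λ ∈ ℝ. -/
open Matrix

/-- The extended-real function `f` is real-valued, nonnegative and homogeneous of degree two. -/
def IsNonnegTwoHomogeneous {E : Type*} [SMul ℝ E] (f : E → EReal) : Prop :=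
  ∃ g : E → ℝ, (∀ x, f x = (g x : EReal)) ∧ (∀ x, 0 ≤ g x) ∧
    ∀ (c : ℝ) (x : E), g (c • x) = c ^ 2 * g x

theorem coe_ciInf_of_nonneg {J : Type*} [Nonempty J] {G : J → ℝ} (hG : ∀ j, 0 ≤ G j) :
    ((⨅ j, G j : ℝ) : EReal) = ⨅ j, (G j : EReal) := by
  have hbdd : BddBelow (Set.range G) := ⟨0, by rintro _ ⟨j, rfl⟩; exact hG j⟩
  exact Monotone.map_ciInf_of_continuousAt continuous_coe_real_ereal.continuousAt
    EReal.coe_strictMono.monotone hbdd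

/-- An infimum of nonnegative functions indexed by `J` is homogeneous of degree two as soon as
scaling the argument can be compensated by a change of index. -/
theorem isNonnegTwoHomogeneous_iInf {E J : Type*} [AddCommGroup E] [Module ℝ E] [Nonempty J]
    {G : J → E → ℝ} (hG : ∀ j x, 0 ≤ G j x)
    (hscale : ∀ (c : ℝ) (j : J), ∃ k, ∀ x, G k (c • x) = c ^ 2 * G j x) :
    IsNonnegTwoHomogeneous fun x => ⨅ j, (G j x : EReal) := by
  have hbdd (x : E) : BddBelow (Set.range fun j => G j x) :=
    ⟨0, by rintro _ ⟨j, rfl⟩; exact hG j x⟩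
  have hle (c : ℝ) (x : E) : ⨅ j, G j (c • x) ≤ c ^ 2 * ⨅ j, G j x := by
    rw [Real.mul_iInf_of_nonneg (sq_nonneg c)]
    refine le_ciInf fun j => ?_
    obtain ⟨k, hk⟩ := hscale c j
    exact (ciInf_le (hbdd _) k).trans_eq (hk x)
  have hnonneg (x : E) : 0 ≤ ⨅ j, G j x := le_ciInf fun j => hG j x
  refine ⟨fun x => ⨅ j, G j x, fun x => (coe_ciInf_of_nonneg fun j => hG j x).symm,
    hnonneg, fun c x => (hle c x).antisymm ?_⟩
  rcases eq_or_ne c 0 with rfl | hc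
  · simpa using hnonneg 0
  · have h := hle c⁻¹ (c • x)
    rw [inv_smul_smul₀ hc] at h
    calc c ^ 2 * ⨅ j, G j x ≤ c ^ 2 * (c⁻¹ ^ 2 * ⨅ j, G j (c • x)) := by gcongr
      _ = ⨅ j, G j (c • x) := by field_simp

theorem smul_dotProduct_mulVec_smul {ι : Type*} [Fintype ι] (Q : Matrix ι ι ℝ) (c : ℝ)
    (x : ι → ℝ) : (c • x) ⬝ᵥ Q.mulVec (c • x) = c ^ 2 * (x ⬝ᵥ Q.mulVec x) := by
  rw [mulVec_smul, smul_dotProduct, dotProduct_smul, smul_eq_mul, smul_eq_mul]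
  ring

theorem isNonnegTwoHomogeneous_iInf_quadratic {ι I : Type*} [Fintype ι] [Nonempty I]
    {M : I → Matrix ι ι ℝ} (hM : ∀ i, (M i).PosSemidef) :
    IsNonnegTwoHomogeneous fun x => ⨅ i, ((x ⬝ᵥ (M i).mulVec x : ℝ) : EReal) :=
  isNonnegTwoHomogeneous_iInf (fun i x => by simpa using (hM i).dotProduct_mulVec_nonneg x)
    fun c i => ⟨i, fun x => smul_dotProduct_mulVec_smul (M i) c x⟩

/-- The Bellman operator of a switched linear-quadratic problem preserves nonnegative
functions that are homogeneous of degree two. -/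
theorem IsNonnegTwoHomogeneous.bellman {ν μ ι : Type*} [Fintype ν] [Fintype μ] [Nonempty ι]
    {A : ι → Matrix ν ν ℝ} {B : ι → Matrix ν μ ℝ} {C : ι → Matrix ν ν ℝ}
    {D : ι → Matrix μ μ ℝ} (hC : ∀ v, (C v).PosSemidef) (hD : ∀ v, (D v).PosSemidef)
    {W : (ν → ℝ) → EReal} (hW : IsNonnegTwoHomogeneous W) :
    IsNonnegTwoHomogeneous fun x => ⨅ v : ι, ⨅ u : μ → ℝ,
      ((x ⬝ᵥ (C v).mulVec x + u ⬝ᵥ (D v).mulVec u : ℝ) : EReal) +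
        W ((A v).mulVec x + (B v).mulVec u) := by
  obtain ⟨g, hg, hg0, hgc⟩ := hW
  simp only [hg, ← EReal.coe_add]
  have key : IsNonnegTwoHomogeneous fun x => ⨅ j : ι × (μ → ℝ),
      ((x ⬝ᵥ (C j.1).mulVec x + j.2 ⬝ᵥ (D j.1).mulVec j.2 +
        g ((A j.1).mulVec x + (B j.1).mulVec j.2) : ℝ) : EReal) := by
    refine isNonnegTwoHomogeneous_iInf (fun j x => ?_) fun c j => ⟨(j.1, c • j.2), fun x => ?_⟩
    · have h1 : 0 ≤ x ⬝ᵥ (C j.1).mulVec x := by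
        simpa using (hC j.1).dotProduct_mulVec_nonneg x
      have h2 : 0 ≤ j.2 ⬝ᵥ (D j.1).mulVec j.2 := by
        simpa using (hD j.1).dotProduct_mulVec_nonneg j.2
      exact add_nonneg (add_nonneg h1 h2) (hg0 _)
    · simp only [smul_dotProduct_mulVec_smul]
      rw [mulVec_smul, mulVec_smul, ← smul_add, hgc]
      ring
  simpa only [iInf_prod] using key

/-- 2-homogeneity of the value functions of the switched linear-quadratic problem
(Proposition 5.2): for every `t ∈ {0,…,T}`, the value function `V_t` is real-valued and
`V_t(λx) = λ² V_t(x)` for every `x ∈ ℝⁿ` and `λ ∈ ℝ`. -/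
theorem stmt_10
    (n m T : ℕ) (hn : 0 < n) (hm : 0 < m) (hT : 1 ≤ T)
    -- the finite nonempty set of switching controls
    (ι : Type) [Fintype ι] [Nonempty ι]
    -- dynamics and costs, for `t < T` and `v ∈ 𝒱`
    (A : ℕ → ι → Matrix (Fin n) (Fin n) ℝ)
    (B : ℕ → ι → Matrix (Fin n) (Fin m) ℝ)
    (C : ℕ → ι → Matrix (Fin n) (Fin n) ℝ)
    (D : ℕ → ι → Matrix (Fin m) (Fin m) ℝ)
    (hC : ∀ t < T, ∀ v, (C t v).PosSemidef)
    (hD : ∀ t < T, ∀ v, (D t v).PosDef)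
    -- final cost: a finite min of pure convex quadratic forms
    (I : Type) [Fintype I] [Nonempty I]
    (M : I → Matrix (Fin n) (Fin n) ℝ)
    (hM : ∀ i, (M i).PosSemidef)
    -- the value functions, defined by backward recursion
    (V : ℕ → (Fin n → ℝ) → EReal)
    (hVT : ∀ x, V T x = ⨅ i : I, ((x ⬝ᵥ (M i).mulVec x : ℝ) : EReal))
    (hVrec : ∀ t < T, ∀ x, V t x =
      ⨅ v : ι, ⨅ u : Fin m → ℝ,
        (((x ⬝ᵥ (C t v).mulVec x + u ⬝ᵥ (D t v).mulVec u : ℝ)) : EReal) +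
          V (t + 1) ((A t v).mulVec x + (B t v).mulVec u)) :
    ∀ t ≤ T, ∀ x : Fin n → ℝ,
      (∃ r : ℝ, V t x = (r : EReal)) ∧
      ∀ lam : ℝ, V t (lam • x) = ((lam ^ 2 : ℝ) : EReal) * V t x := by
  have key : ∀ t ≤ T, IsNonnegTwoHomogeneous (V t) := by
    intro t ht
    induction ht using Nat.decreasingInduction with
    | self =>
      rw [funext hVT]
      exact isNonnegTwoHomogeneous_iInf_quadratic hM
    | of_succ t ht ih =>
      rw [funext (hVrec t ht)]
      exact ih.bellman (hC t ht) fun v => (hD t ht v).posSemidef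
  intro t ht x
  obtain ⟨g, hg, -, hgc⟩ := key t ht
  exact ⟨⟨g x, hg x⟩, fun c => by rw [hg, hg, hgc, EReal.coe_mul]⟩
end

section
/- Existence of a stable interval for the Riccati operators (Proposition 5.3, one-step form): let 𝒱 be a finite nonempty set and for each v ∈ 𝒱 let A^v be a real n×n matrix, B^v a real n×m matrix, C^v a symmetric positive semidefinite n×n matrix and D^v a symmetric positive definite m×m matrix. Let α′ ≥ 0 and define α := max_{v∈𝒱} ( α′ · λ_max((A^v)ᵀA^v) + λ_max(C^v) ). Then for every symmetric n×n matrix M with 0 ⪯ M ⪯ α′·Id and every v ∈ 𝒱, the Riccati image R_v(M) := C^v + (A^v)ᵀM A^v − (A^v)ᵀM B^v ( D^v + (B^v)ᵀM B^v )⁻¹ (B^v)ᵀM A^v satisfies 0 ⪯ R_v(M) ⪯ α·Id. -/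
open Matrix

/-- The largest eigenvalue of a symmetric real matrix (junk value `0` if the matrix is
not symmetric). -/
noncomputable def lamMax {N : ℕ} (P : Matrix (Fin N) (Fin N) ℝ) : ℝ :=
  if hP : P.IsHermitian then ⨆ i, hP.eigenvalues i else 0

namespace Matrix

/-- A symmetric real matrix is bounded above, in the Loewner order, by its largest eigenvalue. -/
theorem IsHermitian.posSemidef_lamMax_smul_one_sub {N : ℕ} {P : Matrix (Fin N) (Fin N) ℝ}
    (hP : P.IsHermitian) : (lamMax P • (1 : Matrix (Fin N) (Fin N) ℝ) - P).PosSemidef := by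
  set U : Matrix (Fin N) (Fin N) ℝ := ↑hP.eigenvectorUnitary
  have hU : U * star U = 1 := Unitary.mul_star_self_of_mem hP.eigenvectorUnitary.2
  have hspec : P = U * diagonal hP.eigenvalues * star U := by
    simpa [Unitary.conjStarAlgAut_apply, Function.comp_def] using hP.spectral_theorem
  have hdiag : (diagonal fun i => lamMax P - hP.eigenvalues i).PosSemidef :=
    PosSemidef.diagonal fun i => by
      simpa only [lamMax, dif_pos hP, Pi.zero_apply, sub_nonneg] using
        le_ciSup (Set.finite_range hP.eigenvalues).bddAbove i
  have hconj := hdiag.mul_mul_conjTranspose_same U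
  have hsub : (diagonal fun i => lamMax P - hP.eigenvalues i)
      = lamMax P • (1 : Matrix (Fin N) (Fin N) ℝ) - diagonal hP.eigenvalues := by
    rw [smul_one_eq_diagonal, diagonal_sub]
  rw [hsub, ← star_eq_conjTranspose, mul_sub, sub_mul, ← hspec, mul_smul_comm, mul_one,
    smul_mul_assoc, hU] at hconj
  exact hconj

section Riccati

variable {l n m : Type*} [Fintype l] [Fintype n] [Fintype m]

/-- The matrix inverted by the Riccati operator is positive definite. -/
theorem PosDef.add_transpose_mul_mul_same {D : Matrix m m ℝ} {M : Matrix n n ℝ} (hD : D.PosDef)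
    (hM : M.PosSemidef) (B : Matrix n m ℝ) : (D + Bᵀ * M * B).PosDef :=
  hD.add_posSemidef (by simpa using hM.conjTranspose_mul_mul_same B)

/-- The Riccati image of a positive semidefinite matrix is positive semidefinite. -/
theorem PosSemidef.riccati [DecidableEq m] {C : Matrix l l ℝ} {D : Matrix m m ℝ} {M : Matrix n n ℝ}
    (hC : C.PosSemidef) (hD : D.PosDef) (hM : M.PosSemidef) (A : Matrix n l ℝ)
    (B : Matrix n m ℝ) :
    (C + Aᵀ * M * A - Aᵀ * M * B * (D + Bᵀ * M * B)⁻¹ * (Bᵀ * M * A)).PosSemidef := by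
  have hS := hD.add_transpose_mul_mul_same hM B
  let _ := hS.isUnit.invertible
  let _ := hD.isUnit.invertible
  have hMt : Mᵀ = M := by simpa using hM.isHermitian.eq
  have hCD : (fromBlocks C 0 (0 : Matrix l m ℝ)ᴴ D).PosSemidef :=
    (PosDef.fromBlocks₂₂ C 0 hD).2 (by simpa using hC)
  have hblock := hCD.add (hM.conjTranspose_mul_mul_same (fromCols A B))
  have hoff : Bᵀ * M * A = (Aᵀ * M * B)ᴴ := by simp [Matrix.mul_assoc, hMt]
  rw [hoff, ← PosDef.fromBlocks₂₂ _ _ hS, ← hoff]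
  rw [conjTranspose_fromCols_eq_fromRows_conjTranspose, fromRows_mul, fromRows_mul_fromCols,
    fromBlocks_add] at hblock
  simpa using hblock

end Riccati

end Matrix

/-- Existence of a stable interval for the Riccati operators (Proposition 5.3, one-step
form): if `0 ⪯ M ⪯ α'·Id` then for every switching control `v` the Riccati image
`R_v(M)` satisfies `0 ⪯ R_v(M) ⪯ α·Id`, where
`α = max_v (α'·λ_max((Aᵛ)ᵀAᵛ) + λ_max(Cᵛ))`. -/
theorem stmt_11
    (n m : ℕ)
    -- the finite nonempty set of switching controls
    (ι : Type) [Fintype ι] [Nonempty ι]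
    (A : ι → Matrix (Fin n) (Fin n) ℝ)
    (B : ι → Matrix (Fin n) (Fin m) ℝ)
    (C : ι → Matrix (Fin n) (Fin n) ℝ)
    (D : ι → Matrix (Fin m) (Fin m) ℝ)
    (hC : ∀ v, (C v).PosSemidef)
    (hD : ∀ v, (D v).PosDef)
    (α' : ℝ) (hα' : 0 ≤ α')
    (α : ℝ) (hα : α = ⨆ v : ι, (α' * lamMax ((A v)ᵀ * A v) + lamMax (C v))) :
    ∀ M : Matrix (Fin n) (Fin n) ℝ,
      M.IsHermitian → M.PosSemidef →
      (α' • (1 : Matrix (Fin n) (Fin n) ℝ) - M).PosSemidef →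
      ∀ v : ι,
        let R := C v + (A v)ᵀ * M * A v -
          (A v)ᵀ * M * B v * (D v + (B v)ᵀ * M * B v)⁻¹ * ((B v)ᵀ * M * A v)
        R.PosSemidef ∧ (α • (1 : Matrix (Fin n) (Fin n) ℝ) - R).PosSemidef := by
  intro M _ hM hMα v
  refine ⟨(hC v).riccati (hD v) hM (A v) (B v), ?_⟩
  have hMt : Mᵀ = M := by simpa using hM.isHermitian.eq
  have hα_ge : 0 ≤ α - (α' * lamMax ((A v)ᵀ * A v) + lamMax (C v)) := by
    rw [hα, sub_nonneg]
    exact le_ciSup (f := fun v => α' * lamMax ((A v)ᵀ * A v) + lamMax (C v))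
      (Set.finite_range _).bddAbove v
  have hα_psd := PosSemidef.one (n := Fin n) (R := ℝ) |>.smul hα_ge
  have hA_psd := (isHermitian_conjTranspose_mul_self (A v)).posSemidef_lamMax_smul_one_sub.smul hα'
  have hC_psd := (hC v).isHermitian.posSemidef_lamMax_smul_one_sub
  have hM_psd := hMα.conjTranspose_mul_mul_same (A v)
  have hS := (hD v).add_transpose_mul_mul_same hM (B v)
  have hS_psd := hS.inv.posSemidef.conjTranspose_mul_mul_same ((B v)ᵀ * M * A v)
  have hsum := (((hα_psd.add hA_psd).add hC_psd).add hM_psd).add hS_psd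
  convert hsum using 1
  simp only [conjTranspose_eq_transpose_of_trivial, transpose_mul, transpose_transpose, hMt,
    mul_sub, sub_mul, Matrix.mul_assoc, smul_sub, sub_smul, add_smul, smul_smul, mul_smul_comm,
    Matrix.smul_mul, Matrix.one_mul]
  abel
end

section
/- The value functions of the switched linear-quadratic problem are finite infima of convex pure quadratic forms (Lemma 5.5): for every t ∈ {0,…,T} there exists a finite nonempty set F_t of symmetric positive semidefinite n×n matrices such that V_t(x) = min_{P ∈ F_t} xᵀP x for every x ∈ ℝⁿ. -/
open Matrix

namespace Matrix

variable {n m : Type*} [Fintype n] [Fintype m]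

theorem IsSymm.dotProduct_mulVec_comm {R : Type*} [CommSemiring R] {P : Matrix n n R}
    (hP : P.IsSymm) (x y : n → R) : x ⬝ᵥ P *ᵥ y = y ⬝ᵥ P *ᵥ x := by
  rw [dotProduct_comm, ← vecMul_transpose, hP.eq, ← dotProduct_mulVec]

theorem IsSymm.quadratic_add {R : Type*} [CommRing R] {P : Matrix n n R}
    (hP : P.IsSymm) (x y : n → R) :
    (x + y) ⬝ᵥ P *ᵥ (x + y) = x ⬝ᵥ P *ᵥ x + 2 * (y ⬝ᵥ P *ᵥ x) + y ⬝ᵥ P *ᵥ y := by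
  rw [mulVec_add, dotProduct_add, add_dotProduct, add_dotProduct,
    hP.dotProduct_mulVec_comm x y]
  ring

theorem dotProduct_transpose_mul_mul_mulVec {R : Type*} [CommSemiring R]
    (N : Matrix m m R) (L : Matrix m n R) (x : n → R) :
    x ⬝ᵥ (Lᵀ * N * L) *ᵥ x = (L *ᵥ x) ⬝ᵥ N *ᵥ (L *ᵥ x) := by
  rw [← mulVec_mulVec, ← mulVec_mulVec, dotProduct_mulVec, vecMul_transpose]

/-- Minimizing a one-step linear-quadratic cost over the control yields a positive semidefinite
pure quadratic form in the state, and the minimum is attained. -/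
theorem exists_posSemidef_isLeast_linearQuadratic
    (A : Matrix n n ℝ) (B : Matrix n m ℝ) {C : Matrix n n ℝ} {D : Matrix m m ℝ}
    {P : Matrix n n ℝ} (hC : C.PosSemidef) (hD : D.PosDef) (hP : P.PosSemidef) :
    ∃ Q : Matrix n n ℝ, Q.PosSemidef ∧ ∀ x, IsLeast
      (Set.range fun u : m → ℝ => x ⬝ᵥ C *ᵥ x + u ⬝ᵥ D *ᵥ u +
        (A *ᵥ x + B *ᵥ u) ⬝ᵥ P *ᵥ (A *ᵥ x + B *ᵥ u)) (x ⬝ᵥ Q *ᵥ x) := by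
  classical
  have hDs : D.IsSymm := by simpa [IsHermitian, IsSymm] using hD.isHermitian
  have hPs : P.IsSymm := by simpa [IsHermitian, IsSymm] using hP.isHermitian
  have hS : (D + Bᵀ * P * B).PosDef := by
    simpa using hD.add_posSemidef (hP.conjTranspose_mul_mul_same B)
  set K : Matrix m n ℝ := -((D + Bᵀ * P * B)⁻¹ * (Bᵀ * P * A)) with hK
  have hstat : D * K + Bᵀ * P * (A + B * K) = 0 := by
    have h : (D + Bᵀ * P * B) * K = -(Bᵀ * P * A) := by
      rw [hK, Matrix.mul_neg, ← Matrix.mul_assoc,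
        mul_nonsing_inv _ ((isUnit_iff_isUnit_det _).mp hS.isUnit), Matrix.one_mul]
    rw [Matrix.mul_add, ← Matrix.mul_assoc (Bᵀ * P), add_left_comm, ← Matrix.add_mul, h,
      add_neg_cancel]
  refine ⟨C + Kᵀ * D * K + (A + B * K)ᵀ * P * (A + B * K), ?_, fun x => ?_⟩
  · simpa using (hC.add (hD.posSemidef.conjTranspose_mul_mul_same K)).add
      (hP.conjTranspose_mul_mul_same (A + B * K))
  have hQ : x ⬝ᵥ (C + Kᵀ * D * K + (A + B * K)ᵀ * P * (A + B * K)) *ᵥ x =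
      x ⬝ᵥ C *ᵥ x + (K *ᵥ x) ⬝ᵥ D *ᵥ (K *ᵥ x) +
        (A *ᵥ x + B *ᵥ (K *ᵥ x)) ⬝ᵥ P *ᵥ (A *ᵥ x + B *ᵥ (K *ᵥ x)) := by
    rw [add_mulVec, add_mulVec, dotProduct_add, dotProduct_add,
      dotProduct_transpose_mul_mul_mulVec, dotProduct_transpose_mul_mul_mulVec, add_mulVec,
      mulVec_mulVec x B K]
  rw [hQ]
  refine ⟨⟨K *ᵥ x, rfl⟩, ?_⟩
  rintro _ ⟨u, rfl⟩
  obtain ⟨w, rfl⟩ : ∃ w, u = K *ᵥ x + w := ⟨u - K *ᵥ x, by simp⟩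
  have hcross : w ⬝ᵥ D *ᵥ (K *ᵥ x) +
      (B *ᵥ w) ⬝ᵥ P *ᵥ (A *ᵥ x + B *ᵥ (K *ᵥ x)) = 0 := by
    have h := congrArg (fun N : Matrix m n ℝ => w ⬝ᵥ N *ᵥ x) hstat
    simp only [add_mulVec, ← mulVec_mulVec, dotProduct_add, zero_mulVec, dotProduct_zero] at h
    rw [dotProduct_mulVec w Bᵀ, vecMul_transpose] at h
    exact h
  have hw : 0 ≤ w ⬝ᵥ D *ᵥ w := by simpa using hD.posSemidef.dotProduct_mulVec_nonneg w
  have hBw : 0 ≤ (B *ᵥ w) ⬝ᵥ P *ᵥ (B *ᵥ w) := by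
    simpa using hP.dotProduct_mulVec_nonneg (B *ᵥ w)
  have hsplit : A *ᵥ x + B *ᵥ (K *ᵥ x + w) = (A *ᵥ x + B *ᵥ (K *ᵥ x)) + B *ᵥ w := by
    rw [mulVec_add, add_assoc]
  simp only [hsplit, hDs.quadratic_add, hPs.quadratic_add]
  linarith

end Matrix

/-- The value functions of the switched linear-quadratic problem are finite infima of
convex pure quadratic forms (Lemma 5.5): for every `t ∈ {0,…,T}` there is a finite
nonempty set `F_t` of symmetric positive semidefinite matrices with
`V_t(x) = min_{P ∈ F_t} xᵀPx` for every `x`. -/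
theorem stmt_12
    (n m T : ℕ) (hn : 0 < n) (hm : 0 < m) (hT : 1 ≤ T)
    -- the finite nonempty set of switching controls
    (ι : Type) [Fintype ι] [Nonempty ι]
    -- dynamics and costs, for `t < T` and `v ∈ 𝒱`
    (A : ℕ → ι → Matrix (Fin n) (Fin n) ℝ)
    (B : ℕ → ι → Matrix (Fin n) (Fin m) ℝ)
    (C : ℕ → ι → Matrix (Fin n) (Fin n) ℝ)
    (D : ℕ → ι → Matrix (Fin m) (Fin m) ℝ)
    (hC : ∀ t < T, ∀ v, (C t v).PosSemidef)
    (hD : ∀ t < T, ∀ v, (D t v).PosDef)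
    -- final cost: a finite min of pure convex quadratic forms
    (I : Type) [Fintype I] [Nonempty I]
    (M : I → Matrix (Fin n) (Fin n) ℝ)
    (hM : ∀ i, (M i).PosSemidef)
    -- the value functions, defined by backward recursion
    (V : ℕ → (Fin n → ℝ) → EReal)
    (hVT : ∀ x, V T x = ⨅ i : I, ((x ⬝ᵥ (M i).mulVec x : ℝ) : EReal))
    (hVrec : ∀ t < T, ∀ x, V t x =
      ⨅ v : ι, ⨅ u : Fin m → ℝ,
        (((x ⬝ᵥ (C t v).mulVec x + u ⬝ᵥ (D t v).mulVec u : ℝ)) : EReal) +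
          V (t + 1) ((A t v).mulVec x + (B t v).mulVec u)) :
    ∀ t ≤ T, ∃ F : Finset (Matrix (Fin n) (Fin n) ℝ), ∃ hF : F.Nonempty,
      (∀ P ∈ F, P.PosSemidef) ∧
      ∀ x : Fin n → ℝ,
        V t x = ((F.inf' hF fun P => x ⬝ᵥ P.mulVec x : ℝ) : EReal) := by
  intro t ht
  classical
  induction ht using Nat.decreasingInduction with
  | self =>
    refine ⟨Finset.univ.image M, Finset.univ_nonempty.image M, by simpa using hM, fun x => ?_⟩
    rw [hVT]
    apply le_antisymm
    · obtain ⟨P, hP, h⟩ := Finset.exists_mem_eq_inf' (Finset.univ_nonempty.image M)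
        fun P => x ⬝ᵥ P *ᵥ x
      obtain ⟨i, -, rfl⟩ := Finset.mem_image.mp hP
      rw [h]
      exact iInf_le _ i
    · refine le_iInf fun i => EReal.coe_le_coe_iff.mpr ?_
      exact Finset.inf'_le (fun P => x ⬝ᵥ P *ᵥ x)
        (Finset.mem_image_of_mem M (Finset.mem_univ i))
  | of_succ t ht ih =>
    obtain ⟨F, hF, hFpos, hFV⟩ := ih
    choose Q hQpos hQ using fun (v : ι) (P : F) =>
      exists_posSemidef_isLeast_linearQuadratic (A t v) (B t v) (hC t ht v) (hD t ht v)
        (hFpos P P.2)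
    have : Nonempty F := hF.to_subtype
    have hG : (Finset.univ.image fun p : ι × F => Q p.1 p.2).Nonempty :=
      Finset.univ_nonempty.image _
    refine ⟨_, hG, ?_, fun x => ?_⟩
    · intro R hR
      obtain ⟨p, -, rfl⟩ := Finset.mem_image.mp hR
      exact hQpos p.1 p.2
    rw [hVrec t ht]
    simp only [hFV, ← EReal.coe_add]
    apply le_antisymm
    · obtain ⟨R, hR, h⟩ := Finset.exists_mem_eq_inf' hG fun P => x ⬝ᵥ P *ᵥ x
      obtain ⟨⟨v, P⟩, -, rfl⟩ := Finset.mem_image.mp hR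
      obtain ⟨u, hu⟩ := (hQ v P x).1
      rw [h, ← hu]
      refine iInf₂_le_of_le v u (EReal.coe_le_coe_iff.mpr (add_le_add le_rfl ?_))
      exact Finset.inf'_le (fun P => (A t v *ᵥ x + B t v *ᵥ u) ⬝ᵥ P *ᵥ
        (A t v *ᵥ x + B t v *ᵥ u)) P.2
    · refine le_iInf₂ fun v u => EReal.coe_le_coe_iff.mpr ?_
      obtain ⟨P, hP, h⟩ := Finset.exists_mem_eq_inf' hF fun P =>
        (A t v *ᵥ x + B t v *ᵥ u) ⬝ᵥ P *ᵥ (A t v *ᵥ x + B t v *ᵥ u)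
      rw [h]
      exact (Finset.inf'_le (fun P => x ⬝ᵥ P *ᵥ x) (Finset.mem_image_of_mem
        (fun p : ι × F => Q p.1 p.2) (Finset.mem_univ (v, ⟨P, hP⟩)))).trans
          ((hQ v ⟨P, hP⟩ x).2 ⟨u, rfl⟩)
end

section
/- Correctness of the homogenization of the constrained linear-quadratic switched problem (equation (6.4) of Section 6): for every t ∈ {0,…,T} and every x ∈ ℝⁿ, V_t(x) = Ṽ_t(x, 1). Moreover each homogenized value function Ṽ_t is 2-homogeneous: Ṽ_t(λx, λy) = λ² Ṽ_t(x, y) for every (x,y) ∈ ℝⁿ × ℝ and every λ ∈ ℝ. -/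
open Matrix

/-- Correctness of the homogenization of the constrained linear-quadratic switched
problem (equation (6.4) of Section 6): for every `t` and `x`, `V_t(x) = Ṽ_t(x,1)`, and
each homogenized value function `Ṽ_t` is 2-homogeneous:
`Ṽ_t(λx, λy) = λ² Ṽ_t(x,y)`. -/
theorem stmt_16
    (n m T : ℕ) (hn : 0 < n) (hm : 0 < m) (hT : 1 ≤ T)
    -- the finite nonempty set of switching controls `𝒱 ⊂ ℝ`
    (Vs : Finset ℝ) (hVs : Vs.Nonempty)
    -- dynamics and costs, for `t < T`
    (A : ℕ → Matrix (Fin n) (Fin n) ℝ)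
    (B : ℕ → Matrix (Fin n) (Fin m) ℝ)
    (b : ℕ → Fin n → ℝ)
    (C : ℕ → Matrix (Fin n) (Fin n) ℝ) (hC : ∀ t < T, (C t).PosSemidef)
    (D : ℕ → Matrix (Fin m) (Fin m) ℝ) (hD : ∀ t < T, (D t).PosDef)
    (d : ℕ → ℝ) (hd : ∀ t < T, 0 < d t)
    (M : Matrix (Fin n) (Fin n) ℝ) (hM : M.PosSemidef)
    -- the value functions of the constrained problem
    (V : ℕ → (Fin n → ℝ) → EReal)
    (hVT : ∀ x, V T x = ((x ⬝ᵥ M.mulVec x : ℝ) : EReal))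
    (hVrec : ∀ t < T, ∀ x, V t x =
      ⨅ v ∈ Vs, ⨅ u : Fin m → ℝ,
        (((x ⬝ᵥ (C t).mulVec x + u ⬝ᵥ (D t).mulVec u + v ^ 2 * d t : ℝ)) : EReal) +
          V (t + 1) ((A t).mulVec x + (B t).mulVec u + v • b t))
    -- the homogenized value functions
    (Vh : ℕ → (Fin n → ℝ) × ℝ → EReal)
    (hVhT : ∀ p : (Fin n → ℝ) × ℝ, Vh T p = ((p.1 ⬝ᵥ M.mulVec p.1 : ℝ) : EReal))
    (hVhrec : ∀ t < T, ∀ p : (Fin n → ℝ) × ℝ, Vh t p =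
      ⨅ v ∈ Vs, ⨅ u : Fin m → ℝ,
        (((p.1 ⬝ᵥ (C t).mulVec p.1 + u ⬝ᵥ (D t).mulVec u
            + v ^ 2 * p.2 ^ 2 * d t : ℝ)) : EReal) +
          Vh (t + 1) ((A t).mulVec p.1 + (B t).mulVec u + (v * p.2) • b t, p.2)) :
    ∀ t ≤ T,
      (∀ x : Fin n → ℝ, V t x = Vh t (x, 1)) ∧
      ∀ (x : Fin n → ℝ) (y lam : ℝ),
        Vh t (lam • x, lam * y) = ((lam ^ 2 : ℝ) : EReal) * Vh t (x, y) := by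
  have hquad : ∀ {k : ℕ} (N : Matrix (Fin k) (Fin k) ℝ) (c : ℝ) (x : Fin k → ℝ),
      (c • x) ⬝ᵥ N.mulVec (c • x) = c ^ 2 * (x ⬝ᵥ N.mulVec x) := by
    intro k N c x
    simp only [mulVec_smul, smul_dotProduct, dotProduct_smul, smul_eq_mul]
    ring
  have hpos : ∀ {k : ℕ} {N : Matrix (Fin k) (Fin k) ℝ}, N.PosSemidef →
      ∀ x : Fin k → ℝ, 0 ≤ x ⬝ᵥ N.mulVec x := by
    intro k N hN x
    simpa using hN.dotProduct_mulVec_nonneg x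
  have main : ∀ t ≤ T, (∀ x : Fin n → ℝ, V t x = Vh t (x, 1)) ∧ (∀ p, 0 ≤ Vh t p) ∧
      Vh t (0, 0) ≤ 0 ∧ ∀ (x : Fin n → ℝ) (y lam : ℝ), lam ≠ 0 →
        ((lam ^ 2 : ℝ) : EReal) * Vh t (x, y) ≤ Vh t (lam • x, lam * y) := by
    intro t ht
    induction ht using Nat.decreasingInduction with
    | self =>
      refine ⟨fun x => by rw [hVT, hVhT], fun p => ?_, ?_, fun x y lam _ => ?_⟩
      · rw [hVhT]
        exact_mod_cast hpos hM _
      · simp [hVhT]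
      · rw [hVhT, hVhT, ← EReal.coe_mul]
        simp only [hquad, le_refl]
    | of_succ t ht ih =>
      obtain ⟨ihV, ihpos, ihzero, ihhom⟩ := ih
      refine ⟨fun x => ?_, fun p => ?_, ?_, fun x y lam hlam => ?_⟩
      · simp [hVrec t ht, hVhrec t ht, ihV]
      · rw [hVhrec t ht]
        refine le_iInf₂ fun v _ => le_iInf fun u => add_nonneg ?_ (ihpos _)
        have h1 := hpos (hC t ht) p.1
        have h2 := hpos (hD t ht).posSemidef u
        have h3 := hd t ht
        exact_mod_cast (by positivity)
      · obtain ⟨v, hv⟩ := hVs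
        rw [hVhrec t ht]
        refine (iInf₂_le v hv).trans ((iInf_le _ 0).trans ?_)
        simpa using ihzero
      · rw [hVhrec t ht (lam • x, lam * y)]
        refine le_iInf₂ fun v hv => le_iInf fun u => ?_
        obtain ⟨w, rfl⟩ : ∃ w, u = lam • w := ⟨lam⁻¹ • u, by simp [hlam]⟩
        have hle : Vh t (x, y) ≤ _ :=
          (hVhrec t ht (x, y)).trans_le ((iInf₂_le v hv).trans (iInf_le _ w))
        refine (mul_le_mul_of_nonneg_left hle
          (EReal.coe_nonneg.2 (sq_nonneg lam))).trans ?_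
        rw [EReal.left_distrib_of_nonneg_of_ne_top (EReal.coe_nonneg.2 (sq_nonneg lam))
          (EReal.coe_ne_top _), ← EReal.coe_mul]
        refine add_le_add (EReal.coe_le_coe_iff.2 (le_of_eq ?_))
          ((ihhom _ _ lam hlam).trans_eq ?_)
        · simp only [hquad]
          ring
        · simp only [mulVec_smul, smul_add, smul_smul]
          congr 4
          ring
  intro t ht
  obtain ⟨hV, hnonneg, hzero, hhom⟩ := main t ht
  refine ⟨hV, fun x y lam => ?_⟩
  rcases eq_or_ne lam 0 with rfl | hlam
  · simpa using le_antisymm hzero (hnonneg _)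
  · refine le_antisymm ?_ (hhom x y lam hlam)
    have h := mul_le_mul_of_nonneg_left (hhom (lam • x) (lam * y) lam⁻¹ (inv_ne_zero hlam))
      (EReal.coe_nonneg.2 (sq_nonneg lam))
    rwa [← mul_assoc, ← EReal.coe_mul, ← mul_pow, mul_inv_cancel₀ hlam, one_pow,
      EReal.coe_one, one_mul, inv_smul_smul₀ hlam, inv_mul_cancel_left₀ hlam] at h
end
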